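/- arXiv:2105.04055 — 8 statements merged into one kernel-verified Lean document; each statement's English description precedes it below -/
import Mathlib

section
/- Let V be a real inner product space, D : V →L[ℝ] V a skew-adjoint continuous linear operator (⟨D v, w⟩ = −⟨v, D w⟩ for all v, w), and φ_L, φ_U ∈ V. Define the linear operator 𝓛 on Z = V × ℝ × ℝ by 𝓛(v, r, s) = (D w, ⟨φ_L, D w⟩, ⟨φ_U, D w⟩) where w = v + r • φ_L + s • φ_U, and equip Z with the product inner product ⟨(v,r,s),(v',r',s')⟩_Z = ⟨v,v'⟩ + r r' + s s'. Then 𝓛 is skew-adjoint on Z: ⟨𝓛 z, z'⟩_Z = −⟨z, 𝓛 z'⟩_Z for all z, z' ∈ Z. -/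
open RealInnerProductSpace

/-- The SAV operator `𝓛(v,r,s) = (D w, ⟪φL, D w⟫, ⟪φU, D w⟫)` with
`w = v + r • φL + s • φU` is skew-adjoint on `Z = V × ℝ × ℝ` with the product
inner product, whenever `D` is skew-adjoint. -/
theorem sav_operator_skew_adjoint
    {V : Type*} [NormedAddCommGroup V] [InnerProductSpace ℝ V]
    (D : V →L[ℝ] V)
    (hD : ∀ v w : V, ⟪D v, w⟫ = -⟪v, D w⟫)
    (φL φU : V) :
    ∀ v v' : V, ∀ r s r' s' : ℝ,
      ⟪D (v + r • φL + s • φU), v'⟫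
        + ⟪φL, D (v + r • φL + s • φU)⟫ * r'
        + ⟪φU, D (v + r • φL + s • φU)⟫ * s'
      = -(⟪v, D (v' + r' • φL + s' • φU)⟫
            + r * ⟪φL, D (v' + r' • φL + s' • φU)⟫
            + s * ⟪φU, D (v' + r' • φL + s' • φU)⟫) := by
  intro v v' r s r' s'
  have h := hD (v + r • φL + s • φU) (v' + r' • φL + s' • φU)
  generalize D (v + r • φL + s • φU) = a at h ⊢
  generalize D (v' + r' • φL + s' • φU) = b at h ⊢
  simp only [inner_add_left, inner_add_right, real_inner_smul_left,
    real_inner_smul_right] at h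
  rw [real_inner_comm a φL, real_inner_comm a φU] at *
  linarith
end

section
/- Let V be a real inner product space, D : V →L[ℝ] V skew-adjoint, and L : V →L[ℝ] V self-adjoint. Let φ_L, φ_U : ℝ → V be arbitrary functions, and let u : ℝ → V, r_L, r_U : ℝ → ℝ be differentiable functions satisfying, for all t: u'(t) = D (L (u t) + 2 r_L(t) • φ_L(t) − 2 r_U(t) • φ_U(t)), r_L'(t) = ⟨φ_L(t), u'(t)⟩, and r_U'(t) = ⟨φ_U(t), u'(t)⟩. Then the modified energy Ẽ(t) := (1/2)⟨u t, L (u t)⟩ + r_L(t)² − r_U(t)² is constant in t. -/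
open RealInnerProductSpace

/-- Conservation of the modified energy `Ẽ = (1/2)⟪u, Lu⟫ + r_L² − r_U²` along
solutions of the SAV system with skew-adjoint `D` and self-adjoint `L`. -/
theorem sav_system_modified_energy_conservation
    {V : Type*} [NormedAddCommGroup V] [InnerProductSpace ℝ V]
    (D : V →L[ℝ] V)
    (hD : ∀ v w : V, ⟪D v, w⟫ = -⟪v, D w⟫)
    (L : V →L[ℝ] V)
    (hL : ∀ v w : V, ⟪L v, w⟫ = ⟪v, L w⟫)
    (φL φU : ℝ → V)
    (u : ℝ → V) (u' : ℝ → V) (rL rU : ℝ → ℝ)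
    (hu : ∀ t : ℝ, HasDerivAt u (u' t) t)
    (hueq : ∀ t : ℝ, u' t = D (L (u t) + (2 * rL t) • φL t - (2 * rU t) • φU t))
    (hrL : ∀ t : ℝ, HasDerivAt rL ⟪φL t, u' t⟫ t)
    (hrU : ∀ t : ℝ, HasDerivAt rU ⟪φU t, u' t⟫ t) :
    ∀ s t : ℝ,
      (1 / 2 : ℝ) * ⟪u s, L (u s)⟫ + (rL s) ^ 2 - (rU s) ^ 2
        = (1 / 2 : ℝ) * ⟪u t, L (u t)⟫ + (rL t) ^ 2 - (rU t) ^ 2 := by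
  have key : ∀ t : ℝ, HasDerivAt
      (fun t => (1 / 2 : ℝ) * ⟪u t, L (u t)⟫ + (rL t) ^ 2 - (rU t) ^ 2) 0 t := by
    intro t
    have hLu : HasDerivAt (fun t => L (u t)) (L (u' t)) t :=
      L.hasFDerivAt.comp_hasDerivAt t (hu t)
    have h := ((((hu t).inner ℝ hLu).const_mul (1 / 2 : ℝ)).add ((hrL t).pow 2)).sub
      ((hrU t).pow 2)
    refine h.congr_deriv ?_
    have h0 : ⟪L (u t) + (2 * rL t) • φL t - (2 * rU t) • φU t, u' t⟫ = 0 := by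
      have h1 := hD (L (u t) + (2 * rL t) • φL t - (2 * rU t) • φU t)
        (L (u t) + (2 * rL t) • φL t - (2 * rU t) • φU t)
      rw [← hueq t, real_inner_comm] at h1
      linarith
    rw [inner_sub_left, inner_add_left, real_inner_smul_left, real_inner_smul_left] at h0
    have h2 := hL (u t) (u' t)
    have h3 := real_inner_comm (u' t) (L (u t))
    norm_num
    linarith
  intro s t
  exact is_const_of_deriv_eq_zero (fun t => (key t).differentiableAt)
    (fun t => (key t).deriv) s t
end

section
/- Let V be a real inner product space, D : V →L[ℝ] V negative semidefinite (⟨D v, v⟩ ≤ 0 for all v), and L : V →L[ℝ] V self-adjoint. Let φ_L, φ_U : ℝ → V be arbitrary functions, and let u : ℝ → V, r_L, r_U : ℝ → ℝ be differentiable functions satisfying, for all t: u'(t) = D (L (u t) + 2 r_L(t) • φ_L(t) − 2 r_U(t) • φ_U(t)), r_L'(t) = ⟨φ_L(t), u'(t)⟩, and r_U'(t) = ⟨φ_U(t), u'(t)⟩. Then the modified energy Ẽ(t) := (1/2)⟨u t, L (u t)⟩ + r_L(t)² − r_U(t)² is monotone nonincreasing in t. -/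
open RealInnerProductSpace

/-- Dissipation of the modified energy `Ẽ = (1/2)⟪u, Lu⟫ + r_L² − r_U²` along
solutions of the SAV system with negative semidefinite `D` and self-adjoint `L`. -/
theorem sav_system_modified_energy_dissipation
    {V : Type*} [NormedAddCommGroup V] [InnerProductSpace ℝ V]
    (D : V →L[ℝ] V)
    (hD : ∀ v : V, ⟪D v, v⟫ ≤ 0)
    (L : V →L[ℝ] V)
    (hL : ∀ v w : V, ⟪L v, w⟫ = ⟪v, L w⟫)
    (φL φU : ℝ → V)
    (u : ℝ → V) (u' : ℝ → V) (rL rU : ℝ → ℝ)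
    (hu : ∀ t : ℝ, HasDerivAt u (u' t) t)
    (hueq : ∀ t : ℝ, u' t = D (L (u t) + (2 * rL t) • φL t - (2 * rU t) • φU t))
    (hrL : ∀ t : ℝ, HasDerivAt rL ⟪φL t, u' t⟫ t)
    (hrU : ∀ t : ℝ, HasDerivAt rU ⟪φU t, u' t⟫ t) :
    Antitone (fun t => (1 / 2 : ℝ) * ⟪u t, L (u t)⟫ + (rL t) ^ 2 - (rU t) ^ 2) := by
  have key : ∀ t : ℝ, HasDerivAt
      (fun t => (1 / 2 : ℝ) * ⟪u t, L (u t)⟫ + (rL t) ^ 2 - (rU t) ^ 2)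
      ⟪u' t, L (u t) + (2 * rL t) • φL t - (2 * rU t) • φU t⟫ t := by
    intro t
    have hLu : HasDerivAt (fun s => L (u s)) (L (u' t)) t :=
      L.hasFDerivAt.comp_hasDerivAt t (hu t)
    have h := ((((hu t).inner ℝ hLu).const_mul (1 / 2 : ℝ)).add ((hrL t).pow 2)).sub
      ((hrU t).pow 2)
    refine h.congr_deriv ?_
    have e : ⟪u t, L (u' t)⟫ = ⟪u' t, L (u t)⟫ := by
      rw [← hL, real_inner_comm]
    rw [e, inner_sub_right, inner_add_right, inner_smul_right, inner_smul_right,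
      real_inner_comm (u' t) (φL t), real_inner_comm (u' t) (φU t)]
    push_cast
    ring
  refine antitone_of_deriv_nonpos (fun t => (key t).differentiableAt) (fun t => ?_)
  rw [(key t).deriv, hueq t]
  exact hD _
end

section
/- Let V be a real inner product space, L : V →L[ℝ] V self-adjoint, and let Z = V × ℝ × ℝ carry the product inner product, with Ẽ(v, r, s) = (1/2)⟨v, L v⟩ + r² − s² and ∇Ẽ(v, r, s) = (L v, 2 r, −2 s). Let A : Z →L[ℝ] Z be any skew-adjoint operator on Z and Δt > 0. If z, z' ∈ Z satisfy the Crank–Nicolson relation z' − z = Δt • A(∇Ẽ((z + z')/2)), then Ẽ(z') = Ẽ(z). -/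
open RealInnerProductSpace

/-- Energy preservation of the Crank–Nicolson-type SAV scheme: if `A` is
skew-adjoint on `Z = V × ℝ × ℝ` (product inner product) and
`z' − z = Δt • A (∇Ẽ((z+z')/2))` with `∇Ẽ(v,r,s) = (Lv, 2r, −2s)`, then
`Ẽ(z') = Ẽ(z)` for `Ẽ(v,r,s) = (1/2)⟪v, Lv⟫ + r² − s²`. -/
theorem sav_cn_energy_preservation
    {V : Type*} [NormedAddCommGroup V] [InnerProductSpace ℝ V]
    (L : V →L[ℝ] V) (hL : ∀ v w : V, ⟪L v, w⟫ = ⟪v, L w⟫)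
    (A : (V × ℝ × ℝ) →L[ℝ] (V × ℝ × ℝ))
    (hA : ∀ z z' : V × ℝ × ℝ,
      ⟪(A z).1, z'.1⟫ + (A z).2.1 * z'.2.1 + (A z).2.2 * z'.2.2
        = -(⟪z.1, (A z').1⟫ + z.2.1 * (A z').2.1 + z.2.2 * (A z').2.2))
    (Δt : ℝ) (hΔt : 0 < Δt)
    (z z' : V × ℝ × ℝ)
    (hCN : z' - z = Δt • A (L ((1 / 2 : ℝ) • (z.1 + z'.1)),
        2 * ((z.2.1 + z'.2.1) / 2), -2 * ((z.2.2 + z'.2.2) / 2))) :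
    (1 / 2 : ℝ) * ⟪z'.1, L z'.1⟫ + z'.2.1 ^ 2 - z'.2.2 ^ 2
      = (1 / 2 : ℝ) * ⟪z.1, L z.1⟫ + z.2.1 ^ 2 - z.2.2 ^ 2 := by
  obtain ⟨u, r, s⟩ := z
  obtain ⟨u', r', s'⟩ := z'
  have key := hA (L ((1 / 2 : ℝ) • (u + u')), 2 * ((r + r') / 2), -2 * ((s + s') / 2))
    (L ((1 / 2 : ℝ) • (u + u')), 2 * ((r + r') / 2), -2 * ((s + s') / 2))
  dsimp only at hCN key ⊢
  generalize A (L ((1 / 2 : ℝ) • (u + u')), 2 * ((r + r') / 2), -2 * ((s + s') / 2)) = w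
    at hCN key
  obtain ⟨a, b, c⟩ := w
  simp only [Prod.mk_sub_mk, Prod.smul_mk, Prod.mk.injEq, smul_eq_mul] at hCN
  obtain ⟨h1, h2, h3⟩ := hCN
  dsimp only at key
  rw [real_inner_comm a] at key
  have h4 : ⟪u' - u, L ((1 / 2 : ℝ) • (u + u'))⟫ =
      Δt * ⟪a, L ((1 / 2 : ℝ) • (u + u'))⟫ := by
    rw [h1, real_inner_smul_left]
  have h5 : ⟪u' - u, L ((1 / 2 : ℝ) • (u + u'))⟫ =
      (1 / 2 : ℝ) * ⟪u', L u'⟫ - (1 / 2 : ℝ) * ⟪u, L u⟫ := by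
    have h6 : ⟪u', L u⟫ = ⟪u, L u'⟫ := by rw [← hL, real_inner_comm]
    simp only [map_smul, map_add, inner_sub_left, inner_add_right, real_inner_smul_right]
    rw [h6]
    ring
  linear_combination h4 - h5 + (r + r') * h2 - (s + s') * h3 + Δt / 2 * key
end

section
/- Let V be a real inner product space, L : V →L[ℝ] V self-adjoint, and let Z = V × ℝ × ℝ carry the product inner product, with Ẽ(v, r, s) = (1/2)⟨v, L v⟩ + r² − s² and ∇Ẽ(v, r, s) = (L v, 2 r, −2 s). Let A : Z →L[ℝ] Z be any negative semidefinite operator on Z (⟨A w, w⟩_Z ≤ 0 for all w ∈ Z) and Δt > 0. If z, z' ∈ Z satisfy z' − z = Δt • A(∇Ẽ((z + z')/2)), then Ẽ(z') ≤ Ẽ(z). -/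
open RealInnerProductSpace

/-- Energy dissipation of the Crank–Nicolson-type SAV scheme: if `A` is
negative semidefinite on `Z = V × ℝ × ℝ` (product inner product) and
`z' − z = Δt • A (∇Ẽ((z+z')/2))` with `∇Ẽ(v,r,s) = (Lv, 2r, −2s)`, then
`Ẽ(z') ≤ Ẽ(z)` for `Ẽ(v,r,s) = (1/2)⟪v, Lv⟫ + r² − s²`. -/
theorem sav_cn_energy_dissipation
    {V : Type*} [NormedAddCommGroup V] [InnerProductSpace ℝ V]
    (L : V →L[ℝ] V) (hL : ∀ v w : V, ⟪L v, w⟫ = ⟪v, L w⟫)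
    (A : (V × ℝ × ℝ) →L[ℝ] (V × ℝ × ℝ))
    (hA : ∀ w : V × ℝ × ℝ,
      ⟪(A w).1, w.1⟫ + (A w).2.1 * w.2.1 + (A w).2.2 * w.2.2 ≤ 0)
    (Δt : ℝ) (hΔt : 0 < Δt)
    (z z' : V × ℝ × ℝ)
    (hCN : z' - z = Δt • A (L ((1 / 2 : ℝ) • (z.1 + z'.1)),
        2 * ((z.2.1 + z'.2.1) / 2), -2 * ((z.2.2 + z'.2.2) / 2))) :
    (1 / 2 : ℝ) * ⟪z'.1, L z'.1⟫ + z'.2.1 ^ 2 - z'.2.2 ^ 2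
      ≤ (1 / 2 : ℝ) * ⟪z.1, L z.1⟫ + z.2.1 ^ 2 - z.2.2 ^ 2 := by
  have h := hA (L ((1 / 2 : ℝ) • (z.1 + z'.1)),
        2 * ((z.2.1 + z'.2.1) / 2), -2 * ((z.2.2 + z'.2.2) / 2))
  generalize A (L ((1 / 2 : ℝ) • (z.1 + z'.1)),
        2 * ((z.2.1 + z'.2.1) / 2), -2 * ((z.2.2 + z'.2.2) / 2)) = y at h hCN
  obtain ⟨u, r, s⟩ := z
  obtain ⟨u', r', s'⟩ := z'
  obtain ⟨a, b, c⟩ := y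
  simp only [Prod.mk_sub_mk, Prod.smul_mk, Prod.mk.injEq, smul_eq_mul] at hCN h ⊢
  obtain ⟨h1, h2, h3⟩ := hCN
  have e : Δt * ⟪a, L ((1 / 2 : ℝ) • (u + u'))⟫
      = (1 / 2 : ℝ) * ⟪u', L u'⟫ - (1 / 2 : ℝ) * ⟪u, L u⟫ := by
    rw [← real_inner_smul_left, ← h1]
    have hs : ⟪u', L u⟫ = ⟪u, L u'⟫ := by
      rw [← hL, real_inner_comm]
    simp only [map_smul, map_add, inner_smul_right, inner_add_right, inner_sub_left, hs]
    ring
  have h4 := mul_nonpos_of_nonneg_of_nonpos hΔt.le h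
  have e2 : Δt * b * (r + r') = r' ^ 2 - r ^ 2 := by rw [← h2]; ring
  have e3 : Δt * c * (s + s') = s' ^ 2 - s ^ 2 := by rw [← h3]; ring
  linarith
end

section
/- Let V be a real inner product space, L : V →L[ℝ] V self-adjoint, and let Z = V × ℝ × ℝ carry the product inner product, with Ẽ(v, r, s) = (1/2)⟨v, L v⟩ + r² − s² and ∇Ẽ(v, r, s) = (L v, 2 r, −2 s). Let A₁, A₂ : Z →L[ℝ] Z be skew-adjoint operators, let Δt > 0, and let (a_{ij})_{1≤i,j≤2}, (b_j)_{1≤j≤2} be real Runge–Kutta coefficients satisfying the canonicity condition b_i b_j = b_i a_{ij} + b_j a_{ji} for all i, j ∈ {1, 2}. Suppose z, z', Z₁, Z₂ ∈ Z satisfy the stage equations Z_i = z + Δt • (a_{i1} • A₁(∇Ẽ(Z₁)) + a_{i2} • A₂(∇Ẽ(Z₂))) for i = 1, 2, and the update z' = z + Δt • (b₁ • A₁(∇Ẽ(Z₁)) + b₂ • A₂(∇Ẽ(Z₂))). Then Ẽ(z') = Ẽ(z). -/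
open RealInnerProductSpace

/-- Energy preservation of two-stage canonical SAV Runge–Kutta schemes: with
skew-adjoint stage operators `A 0, A 1` on `Z = V × ℝ × ℝ` (product inner
product), canonical coefficients `b i * b j = b i * a i j + b j * a j i`,
stage equations and update for the quadratic energy
`Ẽ(v,r,s) = (1/2)⟪v, Lv⟫ + r² − s²` with gradient `∇Ẽ(v,r,s) = (Lv, 2r, −2s)`,
the modified energy is preserved. -/
theorem sav_rk_energy_preservation
    {V : Type*} [NormedAddCommGroup V] [InnerProductSpace ℝ V]
    (L : V →L[ℝ] V) (hL : ∀ v w : V, ⟪L v, w⟫ = ⟪v, L w⟫)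
    (A : Fin 2 → ((V × ℝ × ℝ) →L[ℝ] (V × ℝ × ℝ)))
    (hA : ∀ i : Fin 2, ∀ z z' : V × ℝ × ℝ,
      ⟪(A i z).1, z'.1⟫ + (A i z).2.1 * z'.2.1 + (A i z).2.2 * z'.2.2
        = -(⟪z.1, (A i z').1⟫ + z.2.1 * (A i z').2.1 + z.2.2 * (A i z').2.2))
    (Δt : ℝ) (hΔt : 0 < Δt)
    (a : Fin 2 → Fin 2 → ℝ) (b : Fin 2 → ℝ)
    (hcan : ∀ i j : Fin 2, b i * b j = b i * a i j + b j * a j i)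
    (z z' : V × ℝ × ℝ) (Zs : Fin 2 → V × ℝ × ℝ)
    (hstage : ∀ i : Fin 2, Zs i = z + Δt •
      (a i 0 • A 0 (L (Zs 0).1, 2 * (Zs 0).2.1, -2 * (Zs 0).2.2)
        + a i 1 • A 1 (L (Zs 1).1, 2 * (Zs 1).2.1, -2 * (Zs 1).2.2)))
    (hupdate : z' = z + Δt •
      (b 0 • A 0 (L (Zs 0).1, 2 * (Zs 0).2.1, -2 * (Zs 0).2.2)
        + b 1 • A 1 (L (Zs 1).1, 2 * (Zs 1).2.1, -2 * (Zs 1).2.2))) :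
    (1 / 2 : ℝ) * ⟪z'.1, L z'.1⟫ + z'.2.1 ^ 2 - z'.2.2 ^ 2
      = (1 / 2 : ℝ) * ⟪z.1, L z.1⟫ + z.2.1 ^ 2 - z.2.2 ^ 2 := by
  have key : ∀ i : Fin 2, ∀ K : V × ℝ × ℝ,
      A i (L (Zs i).1, 2 * (Zs i).2.1, -2 * (Zs i).2.2) = K →
      ⟪K.1, L (Zs i).1⟫ + 2 * (K.2.1 * (Zs i).2.1) - 2 * (K.2.2 * (Zs i).2.2) = 0 := by
    intro i K hK
    have h := hA i (L (Zs i).1, 2 * (Zs i).2.1, -2 * (Zs i).2.2)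
      (L (Zs i).1, 2 * (Zs i).2.1, -2 * (Zs i).2.2)
    rw [hK] at h
    simp only at h
    rw [real_inner_comm K.1 (L (Zs i).1)] at h
    linarith
  have k0 := key 0 _ rfl
  have k1 := key 1 _ rfl
  have s0 := hstage 0
  have s1 := hstage 1
  generalize A 0 (L (Zs 0).1, 2 * (Zs 0).2.1, -2 * (Zs 0).2.2) = K at *
  generalize A 1 (L (Zs 1).1, 2 * (Zs 1).2.1, -2 * (Zs 1).2.2) = M at *
  rw [s0] at k0
  rw [s1] at k1
  subst hupdate
  have c00 := hcan 0 0
  have c01 := hcan 0 1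
  have c11 := hcan 1 1
  have e1 : ⟪M.1, L K.1⟫ = ⟪K.1, L M.1⟫ := by rw [← hL, real_inner_comm]
  have e2 : ⟪z.1, L K.1⟫ = ⟪K.1, L z.1⟫ := by rw [← hL, real_inner_comm]
  have e3 : ⟪z.1, L M.1⟫ = ⟪M.1, L z.1⟫ := by rw [← hL, real_inner_comm]
  simp only [Prod.fst_add, Prod.snd_add, Prod.smul_fst, Prod.smul_snd, map_add, map_smul,
    inner_add_left, inner_add_right, real_inner_smul_left, real_inner_smul_right,
    smul_eq_mul, e1, e2, e3] at k0 k1 ⊢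
  linear_combination Δt * b 0 * k0 + Δt * b 1 * k1
    + Δt ^ 2 / 2 * (⟪K.1, L K.1⟫ + 2 * K.2.1 ^ 2 - 2 * K.2.2 ^ 2) * c00
    + Δt ^ 2 * (⟪K.1, L M.1⟫ + 2 * K.2.1 * M.2.1 - 2 * K.2.2 * M.2.2) * c01
    + Δt ^ 2 / 2 * (⟪M.1, L M.1⟫ + 2 * M.2.1 ^ 2 - 2 * M.2.2 ^ 2) * c11
end

section
/- Fix N ∈ ℕ with N ≥ 1 and Δx > 0. Let δ be a skew-symmetric real N×N matrix (δᵀ = −δ). Let u : ℝ → (Fin N → ℝ) be differentiable and satisfy the semi-discretized KdV equation u'(t) = δ.mulVec(−(δ * δ).mulVec (u t) − 3 • (u t * u t)), where the product u t * u t is the entrywise (Hadamard) product. Then the discrete energy E(t) := (Σ_{j} ((1/2) ((δ.mulVec (u t)) j)² − ((u t) j)³)) * Δx is constant in t. -/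
open Finset

lemma skew_dot {N : ℕ} (δ : Matrix (Fin N) (Fin N) ℝ) (hδ : δ.transpose = -δ)
    (v w : Fin N → ℝ) : v ⬝ᵥ δ.mulVec w = -(δ.mulVec v ⬝ᵥ w) := by
  rw [Matrix.dotProduct_mulVec, ← Matrix.mulVec_transpose, hδ, Matrix.neg_mulVec,
    neg_dotProduct]

/-- Conservation of the discrete energy for the spatially discretized KdV
equation `u' = δ(−δ²u − 3 u⊙u)` with a skew-symmetric differentiation matrix δ. -/
theorem kdv_semidiscrete_energy_conservation
    (N : ℕ) (hN : 1 ≤ N) (Δx : ℝ) (hΔx : 0 < Δx)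
    (δ : Matrix (Fin N) (Fin N) ℝ) (hδ : δ.transpose = -δ)
    (u : ℝ → (Fin N → ℝ))
    (hu : ∀ t : ℝ, HasDerivAt u
      (δ.mulVec (-(δ * δ).mulVec (u t) - (3 : ℝ) • (u t * u t))) t) :
    ∀ s t : ℝ,
      (∑ j : Fin N, ((1 / 2 : ℝ) * ((δ.mulVec (u s)) j) ^ 2 - ((u s) j) ^ 3)) * Δx
        = (∑ j : Fin N, ((1 / 2 : ℝ) * ((δ.mulVec (u t)) j) ^ 2 - ((u t) j) ^ 3)) * Δx := by
  have key : ∀ t : ℝ, HasDerivAt (fun t => ∑ j : Fin N,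
      ((1 / 2 : ℝ) * ((δ.mulVec (u t)) j) ^ 2 - ((u t) j) ^ 3)) 0 t := by
    intro t
    set w : Fin N → ℝ := -(δ * δ).mulVec (u t) - (3 : ℝ) • (u t * u t) with hw
    have h1 : ∀ j, HasDerivAt (fun t => u t j) (δ.mulVec w j) t :=
      fun j => hasDerivAt_pi.1 (hu t) j
    have h2 : ∀ j, HasDerivAt (fun t => δ.mulVec (u t) j) (δ.mulVec (δ.mulVec w) j) t := by
      intro j
      simp only [Matrix.mulVec, dotProduct]
      exact HasDerivAt.fun_sum fun i _ => (h1 i).const_mul (δ j i)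
    have h3 := HasDerivAt.fun_sum (u := Finset.univ) fun j _ =>
      (((h2 j).fun_pow 2).const_mul (1 / 2 : ℝ)).fun_sub ((h1 j).fun_pow 3)
    refine h3.congr_deriv ?_
    have e1 : δ.mulVec (u t) ⬝ᵥ δ.mulVec (δ.mulVec w)
        = -((δ * δ).mulVec (u t) ⬝ᵥ δ.mulVec w) := by
      rw [skew_dot δ hδ, Matrix.mulVec_mulVec]
    have e2 : w ⬝ᵥ δ.mulVec w = 0 := by
      have h := skew_dot δ hδ w w
      rw [dotProduct_comm (δ.mulVec w) w] at h
      linarith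
    have e3 : w ⬝ᵥ δ.mulVec w = δ.mulVec (u t) ⬝ᵥ δ.mulVec (δ.mulVec w)
        - (3 : ℝ) * ((u t * u t) ⬝ᵥ δ.mulVec w) := by
      rw [e1]
      conv_lhs => rw [hw]
      rw [sub_dotProduct, neg_dotProduct, smul_dotProduct, smul_eq_mul]
    rw [← e2, e3]
    simp only [dotProduct, Finset.mul_sum, ← Finset.sum_sub_distrib, Pi.mul_apply]
    refine Finset.sum_congr rfl fun j _ => ?_
    push_cast
    ring
  intro s t
  congr 1
  exact is_const_of_deriv_eq_zero (fun t => (key t).differentiableAt)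
    (fun t => (key t).deriv) s t
end

section
/- Let N be an even natural number with N ≥ 2 and L > 0. Let F ∈ ℂ^{N×N} be the discrete Fourier transform matrix F_{jk} = exp(−2πi j k / N) for 0 ≤ j, k ≤ N−1, and let Ξ ∈ ℂ^{N×N} be the diagonal matrix with diagonal entries (2πi/L)·(0, 1, 2, …, N/2 − 1, 0, −(N/2 − 1), …, −2, −1). Then the matrix δ := F⁻¹ Ξ F has all entries real, i.e., for all j, k the imaginary part of δ_{jk} is zero. -/
open Complex Matrix

/-- If conjugating `F` and the diagonal `d` amounts to reindexing by `e`, then `F⁻¹ * diag d * F`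
is fixed by entrywise conjugation. -/
theorem conj_aux {n : Type*} [Fintype n] [DecidableEq n] (F : Matrix n n ℂ) (d : n → ℂ)
    (e : n ≃ n) (hF : Fᴴᵀ = F.submatrix e (Equiv.refl n)) (hd : ∀ j, star (d j) = d (e j))
    (j k : n) : ((F⁻¹ * Matrix.diagonal d * F) j k).im = 0 := by
  have hinv : (F⁻¹)ᴴᵀ = F⁻¹.submatrix (Equiv.refl n) e := by
    rw [Matrix.conjTranspose_nonsing_inv, Matrix.transpose_nonsing_inv, hF,
      Matrix.inv_submatrix_equiv]
  have hentry : ∀ a b, star (F a b) = F (e a) b := fun a b => congrFun (congrFun hF a) b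
  have hientry : ∀ a b, star (F⁻¹ a b) = F⁻¹ a (e b) := fun a b => congrFun (congrFun hinv a) b
  have key : star ((F⁻¹ * Matrix.diagonal d * F) j k) = (F⁻¹ * Matrix.diagonal d * F) j k := by
    simp only [Matrix.mul_apply (M := F⁻¹ * Matrix.diagonal d), Matrix.mul_diagonal, star_sum,
      star_mul', hentry, hientry, hd]
    exact Equiv.sum_comp e (fun x => F⁻¹ j x * d x * F x k)
  exact Complex.conj_eq_iff_im.mp key

/-- The spectral differentiation matrix `δ = F⁻¹ Ξ F`, built from the discrete
Fourier transform matrix `F` with entries `exp(−2πijk/N)` and the diagonal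
matrix `Ξ = (2πi/L)·diag(0, 1, …, N/2 − 1, 0, −(N/2 − 1), …, −1)`, has real
entries. -/
theorem spectral_differentiation_matrix_is_real
    (N : ℕ) (hN : 2 ≤ N) (hNeven : Even N) (L : ℝ) (hL : 0 < L) :
    ∀ j k : Fin N,
      (((Matrix.of (fun j k : Fin N =>
            Complex.exp (-2 * (Real.pi : ℂ) * Complex.I * ((j : ℕ) : ℂ) * ((k : ℕ) : ℂ) / (N : ℂ))))⁻¹
        * Matrix.diagonal (fun j : Fin N =>
            (2 * (Real.pi : ℂ) * Complex.I / (L : ℂ)) *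
              (if (j : ℕ) < N / 2 then ((j : ℕ) : ℂ)
               else if (j : ℕ) = N / 2 then 0
               else ((j : ℕ) : ℂ) - (N : ℂ)))
        * Matrix.of (fun j k : Fin N =>
            Complex.exp (-2 * (Real.pi : ℂ) * Complex.I * ((j : ℕ) : ℂ) * ((k : ℕ) : ℂ) / (N : ℂ)))) j k).im
      = 0 := by
  intro j k
  have : NeZero N := ⟨by omega⟩
  have hN0 : (N : ℂ) ≠ 0 := Nat.cast_ne_zero.mpr (by omega)
  have hval : ∀ a : Fin N, ((a : ℕ) = 0 ∧ ((-a : Fin N) : ℕ) = 0) ∨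
      ((a : ℕ) ≠ 0 ∧ ((-a : Fin N) : ℕ) = N - a) := by
    intro a
    by_cases h : (a : ℕ) = 0
    · left
      refine ⟨h, ?_⟩
      rw [Fin.val_neg', h]
      simp
    · right
      refine ⟨h, ?_⟩
      rw [Fin.val_neg']
      exact Nat.mod_eq_of_lt (by omega)
  refine conj_aux _ _ (Equiv.neg (Fin N)) ?_ ?_ j k
  · ext a b
    simp only [Matrix.transpose_apply, Matrix.conjTranspose_apply, Matrix.of_apply,
      Matrix.submatrix_apply, Equiv.neg_apply, Equiv.refl_apply]
    rw [Complex.star_def, ← Complex.exp_conj]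
    simp only [map_div₀, map_mul, map_neg, map_ofNat, Complex.conj_ofReal, Complex.conj_I,
      map_natCast]
    rcases hval a with ⟨h0, h1⟩ | ⟨h0, h1⟩
    · rw [h0, h1]; simp
    · rw [h1, Nat.cast_sub a.isLt.le, Complex.exp_eq_exp_iff_exists_int]
      refine ⟨((b : ℕ) : ℤ), ?_⟩
      push_cast
      field_simp
      ring
  · intro a
    obtain ⟨m, hm⟩ := hNeven
    have ha := a.isLt
    have hdiv : N / 2 = m := by omega
    simp only [Equiv.neg_apply, hdiv]
    rcases hval a with ⟨h0, h1⟩ | ⟨h0, h1⟩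
    · rw [h0, h1, if_pos (by omega)]; simp
    · rw [h1, Nat.cast_sub a.isLt.le]
      rcases lt_trichotomy (a : ℕ) m with h | h | h
      · rw [if_pos h, if_neg (by omega), if_neg (by omega)]
        simp; ring
      · rw [if_neg (by omega), if_pos h, if_neg (by omega), if_pos (by omega)]
        simp
      · rw [if_neg (by omega), if_neg (by omega), if_pos (by omega)]
        simp; ring
end
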